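/- Let n ≥ 4 and let D_n be the group of even signed permutations of [n] (those signed permutations with an even number of negative values among w(1),...,w(n)). For every pseudo-composition α of n, the type D ribbon number r^D_α = |{w ∈ D_n : D(w) = D(α)}| is odd, where D(w) = {i ∈ {0,...,n-1} : w(i) > w(i+1)} with the convention w(0) := -w(2). -/

import Mathlib

/-- Signed permutations of `[n]`: bijections `w` of `ℤ` with `w(-i) = -w(i)` that fix
all integers of absolute value greater than `n`.  These form the hyperoctahedral
group `Bₙ`. -/
def SignedPerms (n : ℕ) : Set (ℤ → ℤ) :=
  {w | Function.Bijective w ∧ (∀ i : ℤ, w (-i) = -w i) ∧ ∀ i : ℤ, (n : ℤ) < |i| → w i = i}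

/-- The type B descent set `D(w) = {i ∈ {0,…,n-1} : w(i) > w(i+1)}` (note `w(0) = 0`
automatically). -/
def DesB (n : ℕ) (w : ℤ → ℤ) : Set ℕ :=
  {i | i < n ∧ w ((i : ℤ) + 1) < w (i : ℤ)}

/-- A pseudo-composition of `n`: a sequence `(β₁, …, β_ℓ)` with `β₁ ≥ 0`,
`β₂, …, β_ℓ > 0` and `β₁ + ⋯ + β_ℓ = n`. -/
structure PseudoComposition (n : ℕ) where
  parts : List ℕ
  ne_nil : parts ≠ []
  tail_pos : ∀ i ∈ parts.tail, 0 < i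
  sum_eq : parts.sum = n

/-- The descent set `D(β) = {β₁, β₁+β₂, …, β₁+⋯+β_{ℓ-1}} ⊆ {0,…,n-1}` of a
pseudo-composition. -/
def DsetB {n : ℕ} (β : PseudoComposition n) : Set ℕ :=
  {m | ∃ i, 0 < i ∧ i < β.parts.length ∧ (β.parts.take i).sum = m}

/-- The type B ribbon number `r^B_α = |{w ∈ Bₙ : D(w) = D(α)}|`. -/
noncomputable def ribbonB {n : ℕ} (α : PseudoComposition n) : ℕ :=
  Set.ncard {w ∈ SignedPerms n | DesB n w = DsetB α}
/-- Even signed permutations of [n]: those with an even number of negative values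
among w(1), ..., w(n).  These form the group D_n. -/
def EvenSignedPerms (n : ℕ) : Set (ℤ → ℤ) :=
  {w | w ∈ SignedPerms n ∧
    Even (((Finset.Icc (1 : ℤ) (n : ℤ)).filter fun i => w i < 0).card)}

/-- The type D descent set, using the convention w(0) := -w(2). -/
def DesD (n : ℕ) (w : ℤ → ℤ) : Set ℕ :=
  {i | i < n ∧ w ((i : ℤ) + 1) < (if i = 0 then -(w 2) else w (i : ℤ))}

/-- The letter preceding position `i + 1` in the type D word of `w`, with the convention
`w(0) := -w(2)`. -/
def letterBefore (w : ℤ → ℤ) (i : ℕ) : ℤ := if i = 0 then -(w 2) else w (i : ℤ)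

theorem mem_DesD {n : ℕ} {w : ℤ → ℤ} {i : ℕ} :
    i ∈ DesD n w ↔ i < n ∧ w ((i : ℤ) + 1) < letterBefore w i := Iff.rfl

section SignedPerms

variable {n : ℕ} {u w : ℤ → ℤ}

theorem SignedPerms.comp (hu : u ∈ SignedPerms n) (hw : w ∈ SignedPerms n) :
    u ∘ w ∈ SignedPerms n := by
  obtain ⟨hu1, hu2, hu3⟩ := hu
  obtain ⟨hw1, hw2, hw3⟩ := hw
  refine ⟨hu1.comp hw1, fun i => by simp [hw2, hu2], fun i hi => ?_⟩
  simp [hw3 i hi, hu3 i hi]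

theorem SignedPerms.map_zero (hw : w ∈ SignedPerms n) : w 0 = 0 := by
  have := hw.2.1 0
  simp only [neg_zero] at this
  omega

theorem SignedPerms.map_ne_zero (hw : w ∈ SignedPerms n) {i : ℤ} (hi : i ≠ 0) : w i ≠ 0 :=
  fun h => hi (hw.1.1 (h.trans (SignedPerms.map_zero hw).symm))

theorem SignedPerms.abs_mem (hw : w ∈ SignedPerms n) {i : ℤ} (hi : i ∈ Finset.Icc (1 : ℤ) n) :
    |w i| ∈ Finset.Icc (1 : ℤ) n := by
  rw [Finset.mem_Icc] at hi ⊢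
  have h0 := SignedPerms.map_ne_zero hw (i := i) (by omega)
  refine ⟨Int.one_le_abs h0, ?_⟩
  by_contra! h
  have := hw.1.1 (hw.2.2 _ h)
  rw [this, abs_of_pos (by omega)] at h
  omega

theorem SignedPerms.eq_of_abs_eq (hw : w ∈ SignedPerms n) {i j : ℤ} (hi : 1 ≤ i) (hj : 1 ≤ j)
    (h : |w i| = |w j|) : i = j := by
  rcases abs_eq_abs.mp h with h | h
  · exact hw.1.1 h
  · rw [← hw.2.1] at h
    have := hw.1.1 h
    omega

theorem SignedPerms.abs_letter_ne (hw : w ∈ SignedPerms n) (i : ℕ) :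
    |w ((i : ℤ) + 1)| ≠ |letterBefore w i| := by
  intro h
  unfold letterBefore at h
  split_ifs at h with hi
  · subst hi
    rw [abs_neg] at h
    have := SignedPerms.eq_of_abs_eq hw (by simp) (by simp) h
    simp at this
  · have := SignedPerms.eq_of_abs_eq hw (by omega) (by omega) h
    omega

theorem SignedPerms.letterBefore_ne_zero (hw : w ∈ SignedPerms n) (i : ℕ) :
    letterBefore w i ≠ 0 := by
  unfold letterBefore
  split_ifs with hi
  · exact neg_ne_zero.mpr (SignedPerms.map_ne_zero hw (by norm_num))
  · exact SignedPerms.map_ne_zero hw (by omega)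

theorem SignedPerms.letterBefore_comp (hu : u ∈ SignedPerms n) (i : ℕ) :
    letterBefore (u ∘ w) i = u (letterBefore w i) := by
  unfold letterBefore
  split_ifs with hi
  · simp [hu.2.1]
  · rfl

theorem finite_signedPerms (n : ℕ) : (SignedPerms n).Finite := by
  refine Set.Finite.of_injOn (f := fun w (i : Finset.Icc (1 : ℤ) n) => w i)
    (t := Set.pi Set.univ fun _ => Set.Icc (-(n : ℤ)) n) ?_ ?_
    (Set.Finite.pi fun _ => Set.finite_Icc _ _)
  · intro w hw i _
    have := Finset.mem_Icc.mp (SignedPerms.abs_mem hw i.2)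
    exact abs_le.mp this.2
  · intro w hw u hu h
    have key : ∀ i : ℤ, 0 ≤ i → w i = u i := by
      intro i hi
      by_cases hin : (n : ℤ) < i
      · have : (n : ℤ) < |i| := by rwa [abs_of_nonneg hi]
        rw [hw.2.2 i this, hu.2.2 i this]
      · rcases hi.eq_or_lt with rfl | hi
        · rw [SignedPerms.map_zero hw, SignedPerms.map_zero hu]
        · exact congrFun h ⟨i, Finset.mem_Icc.mpr ⟨hi, not_lt.mp hin⟩⟩
    funext i
    rcases le_total 0 i with hi | hi
    · exact key i hi
    · have := key (-i) (by omega)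
      rw [hw.2.1, hu.2.1] at this
      omega

theorem SignedPerms.even_card_iff (hw : w ∈ SignedPerms n) :
    Even ((Finset.Icc (1 : ℤ) n).filter fun i => w i < 0).card ↔
      ∏ i ∈ Finset.Icc (1 : ℤ) n, (w i).sign = 1 := by
  have h : ∏ i ∈ Finset.Icc (1 : ℤ) n, (w i).sign =
      ∏ i ∈ Finset.Icc (1 : ℤ) n, if w i < 0 then (-1 : ℤ) else 1 := by
    refine Finset.prod_congr rfl fun i hi => ?_
    rw [Finset.mem_Icc] at hi
    have := SignedPerms.map_ne_zero hw (i := i) (by omega)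
    split_ifs with h
    · exact Int.sign_eq_neg_one_of_neg h
    · exact Int.sign_eq_one_of_pos (by omega)
  rw [h, Finset.prod_ite, Finset.prod_const, Finset.prod_const_one, mul_one,
    neg_one_pow_eq_one_iff_even (by norm_num)]

theorem SignedPerms.sign_comp (hu : u ∈ SignedPerms n) (x : ℤ) :
    (u x).sign = x.sign * (u |x|).sign := by
  rcases lt_trichotomy x 0 with h | rfl | h
  · rw [abs_of_neg h, hu.2.1, Int.sign_eq_neg_one_of_neg h, Int.sign_neg]
    ring
  · simp [SignedPerms.map_zero hu]
  · rw [abs_of_pos h, Int.sign_eq_one_of_pos h, one_mul]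

theorem EvenSignedPerms.comp (hu : u ∈ EvenSignedPerms n) (hw : w ∈ EvenSignedPerms n) :
    u ∘ w ∈ EvenSignedPerms n := by
  obtain ⟨hu, hu'⟩ := hu
  obtain ⟨hw, hw'⟩ := hw
  have huw := SignedPerms.comp hu hw
  refine ⟨huw, ?_⟩
  rw [SignedPerms.even_card_iff hu] at hu'
  rw [SignedPerms.even_card_iff hw] at hw'
  rw [SignedPerms.even_card_iff huw]
  have hinj : Set.InjOn (fun i => |w i|) (Finset.Icc (1 : ℤ) n : Set ℤ) := by
    intro i hi j hj h
    simp only [Finset.coe_Icc, Set.mem_Icc] at hi hj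
    exact SignedPerms.eq_of_abs_eq hw hi.1 hj.1 h
  have himg : (Finset.Icc (1 : ℤ) n).image (fun i => |w i|) = Finset.Icc (1 : ℤ) n := by
    refine Finset.eq_of_subset_of_card_le ?_ (Finset.card_image_of_injOn hinj).ge
    intro x hx
    obtain ⟨i, hi, rfl⟩ := Finset.mem_image.mp hx
    exact SignedPerms.abs_mem hw hi
  calc ∏ i ∈ Finset.Icc (1 : ℤ) n, ((u ∘ w) i).sign
      = (∏ i ∈ Finset.Icc (1 : ℤ) n, (w i).sign) *
          ∏ i ∈ Finset.Icc (1 : ℤ) n, (u |w i|).sign := by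
        rw [← Finset.prod_mul_distrib]
        exact Finset.prod_congr rfl fun i _ => SignedPerms.sign_comp hu (w i)
    _ = 1 := by
        rw [hw', one_mul, ← Finset.prod_image (f := fun k => (u k).sign) hinj, himg, hu']

end SignedPerms

section Reflections

/-- The reflection exchanging the letters `1` and `2`. -/
def swapOneTwo (x : ℤ) : ℤ :=
  if x = 1 then 2 else if x = 2 then 1 else if x = -1 then -2 else if x = -2 then -1 else x

/-- The reflection exchanging the letters `1` and `-2`. -/
def negSwapOneTwo (x : ℤ) : ℤ :=
  if x = 1 then -2 else if x = 2 then -1 else if x = -1 then 2 else if x = -2 then 1 else x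

/-- The sign change of the two letters `1` and `m`. -/
def flipOne (m x : ℤ) : ℤ := if |x| = 1 ∨ |x| = m then -x else x

theorem swapOneTwo_involutive : Function.Involutive swapOneTwo := by
  intro x; grind [swapOneTwo]

theorem negSwapOneTwo_involutive : Function.Involutive negSwapOneTwo := by
  intro x; grind [negSwapOneTwo]

theorem flipOne_involutive (m : ℤ) : Function.Involutive (flipOne m) := by
  intro x
  unfold flipOne
  split_ifs with h h' <;> simp_all

theorem abs_flipOne (m x : ℤ) : |flipOne m x| = |x| := by
  unfold flipOne
  split_ifs <;> simp

theorem swapOneTwo_mem {n : ℕ} (hn : 2 ≤ n) : swapOneTwo ∈ EvenSignedPerms n := by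
  refine ⟨⟨swapOneTwo_involutive.bijective, ?_, ?_⟩, ?_⟩
  · intro i; unfold swapOneTwo; split_ifs <;> omega
  · intro i hi; rw [lt_abs] at hi; unfold swapOneTwo; split_ifs <;> omega
  · rw [Finset.filter_false_of_mem]
    · simp
    · intro i hi; rw [Finset.mem_Icc] at hi; unfold swapOneTwo; split_ifs <;> omega

theorem negSwapOneTwo_mem {n : ℕ} (hn : 2 ≤ n) : negSwapOneTwo ∈ EvenSignedPerms n := by
  refine ⟨⟨negSwapOneTwo_involutive.bijective, ?_, ?_⟩, ?_⟩
  · intro i; unfold negSwapOneTwo; split_ifs <;> omega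
  · intro i hi; rw [lt_abs] at hi; unfold negSwapOneTwo; split_ifs <;> omega
  · have : ((Finset.Icc (1 : ℤ) n).filter fun i => negSwapOneTwo i < 0) = {1, 2} := by
      ext i
      simp only [Finset.mem_filter, Finset.mem_Icc, Finset.mem_insert, Finset.mem_singleton]
      unfold negSwapOneTwo; split_ifs <;> omega
    rw [this]
    decide

theorem flipOne_mem {n : ℕ} {m : ℤ} (hm : 2 ≤ m) (hmn : m ≤ n) :
    flipOne m ∈ EvenSignedPerms n := by
  refine ⟨⟨(flipOne_involutive m).bijective, ?_, ?_⟩, ?_⟩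
  · intro i
    unfold flipOne
    rw [abs_neg]
    split_ifs <;> rfl
  · intro i hi
    unfold flipOne
    rw [if_neg (by omega)]
  · have : ((Finset.Icc (1 : ℤ) n).filter fun i => flipOne m i < 0) = {1, m} := by
      ext i
      simp only [Finset.mem_filter, Finset.mem_Icc, Finset.mem_insert, Finset.mem_singleton]
      unfold flipOne
      rcases abs_cases i with ⟨h, _⟩ | ⟨h, _⟩ <;> rw [h] <;> split_ifs <;> omega
    rw [this, Finset.card_pair (by omega)]
    exact even_two

theorem eq_of_mul_eq_two {x y : ℤ} (h : x * y = 2) :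
    x = 1 ∧ y = 2 ∨ x = 2 ∧ y = 1 ∨ x = -1 ∧ y = -2 ∨ x = -2 ∧ y = -1 := by
  have hx : x ∣ 2 := ⟨y, h.symm⟩
  have h1 := Int.le_of_dvd (by norm_num) hx
  have h2 := Int.le_of_dvd (by norm_num) ((neg_dvd (a := x)).mpr hx)
  have : -2 ≤ x := by omega
  interval_cases x <;> omega

theorem eq_of_mul_eq_neg_two {x y : ℤ} (h : x * y = -2) :
    x = 1 ∧ y = -2 ∨ x = 2 ∧ y = -1 ∨ x = -1 ∧ y = 2 ∨ x = -2 ∧ y = 1 := by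
  have := eq_of_mul_eq_two (x := x) (y := -y) (by linarith)
  omega

theorem swapOneTwo_mul_eq_two {x y : ℤ} (h : x * y = 2) :
    swapOneTwo x * swapOneTwo y = 2 := by
  rcases eq_of_mul_eq_two h with ⟨rfl, rfl⟩ | ⟨rfl, rfl⟩ | ⟨rfl, rfl⟩ | ⟨rfl, rfl⟩ <;> decide

theorem negSwapOneTwo_mul_eq_two {x y : ℤ} (h : x * y = 2) :
    negSwapOneTwo x * negSwapOneTwo y = 2 := by
  rcases eq_of_mul_eq_two h with ⟨rfl, rfl⟩ | ⟨rfl, rfl⟩ | ⟨rfl, rfl⟩ | ⟨rfl, rfl⟩ <;> decide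

theorem negSwapOneTwo_mul_eq_neg_two {x y : ℤ} (h : x * y = -2) :
    negSwapOneTwo x * negSwapOneTwo y = -2 := by
  rcases eq_of_mul_eq_neg_two h with ⟨rfl, rfl⟩ | ⟨rfl, rfl⟩ | ⟨rfl, rfl⟩ | ⟨rfl, rfl⟩ <;> decide

theorem swapOneTwo_lt_iff {x y : ℤ} (hx : x ≠ 0) (hy : y ≠ 0) (hxy : |x| ≠ |y|)
    (h : x * y ≠ 2) : swapOneTwo x < swapOneTwo y ↔ x < y := by
  rw [Ne, abs_eq_abs] at hxy
  have h1 : ¬(x = 1 ∧ y = 2) := by rintro ⟨rfl, rfl⟩; exact h rfl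
  have h2 : ¬(x = 2 ∧ y = 1) := by rintro ⟨rfl, rfl⟩; exact h rfl
  have h3 : ¬(x = -1 ∧ y = -2) := by rintro ⟨rfl, rfl⟩; exact h rfl
  have h4 : ¬(x = -2 ∧ y = -1) := by rintro ⟨rfl, rfl⟩; exact h rfl
  unfold swapOneTwo
  split_ifs <;> omega

theorem negSwapOneTwo_lt_iff {x y : ℤ} (hx : x ≠ 0) (hy : y ≠ 0) (hxy : |x| ≠ |y|)
    (h : x * y ≠ -2) : negSwapOneTwo x < negSwapOneTwo y ↔ x < y := by
  rw [Ne, abs_eq_abs] at hxy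
  have h1 : ¬(x = 1 ∧ y = -2) := by rintro ⟨rfl, rfl⟩; exact h rfl
  have h2 : ¬(x = 2 ∧ y = -1) := by rintro ⟨rfl, rfl⟩; exact h rfl
  have h3 : ¬(x = -1 ∧ y = 2) := by rintro ⟨rfl, rfl⟩; exact h rfl
  have h4 : ¬(x = -2 ∧ y = 1) := by rintro ⟨rfl, rfl⟩; exact h rfl
  unfold negSwapOneTwo
  split_ifs <;> omega

theorem flipOne_lt_iff {m x y : ℤ} (hx : x ≠ 0) (hy : y ≠ 0) (hxy : |x| ≠ |y|)
    (h : max |x| |y| ≠ m) : flipOne m x < flipOne m y ↔ x < y := by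
  unfold flipOne
  rcases abs_cases x with ⟨h1, _⟩ | ⟨h1, _⟩ <;> rcases abs_cases y with ⟨h2, _⟩ | ⟨h2, _⟩ <;>
    split_ifs <;> omega

theorem flipOne_lt_iff_not {m x y : ℤ} (hm : 2 ≤ m) (hy : |y| < m) (hx : |x| = m) :
    flipOne m x < flipOne m y ↔ ¬ x < y := by
  unfold flipOne
  rcases abs_cases x with ⟨h1, _⟩ | ⟨h1, _⟩ <;> rcases abs_cases y with ⟨h2, _⟩ | ⟨h2, _⟩ <;>
    split_ifs <;> omega

end Reflections

theorem Set.even_ncard_of_involutive_comp {s : Set (ℤ → ℤ)} (hs : s.Finite) {g : ℤ → ℤ}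
    (hg : Function.Involutive g) (hmaps : ∀ w ∈ s, g ∘ w ∈ s) (hne : ∀ w ∈ s, g ∘ w ≠ w) :
    Even s.ncard := by
  rw [Set.ncard_eq_toFinset_card s hs, ← ZMod.natCast_eq_zero_iff_even, Finset.cast_card]
  refine Finset.sum_involution (fun w _ => g ∘ w) ?_ ?_ ?_ ?_
  · intros; decide
  · intro w hw _
    exact hne w (by simpa using hw)
  · intro w hw
    simpa using hmaps w (by simpa using hw)
  · intro w _
    funext i
    exact hg (w i)

section Ribbon

variable {n : ℕ} {J : Set ℕ} {u w : ℤ → ℤ}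

/-- The even signed permutations of `[n]` with type D descent set `J`. -/
def ribbonSet (n : ℕ) (J : Set ℕ) : Set (ℤ → ℤ) := {w ∈ EvenSignedPerms n | DesD n w = J}

theorem finite_ribbonSet (n : ℕ) (J : Set ℕ) : (ribbonSet n J).Finite :=
  (finite_signedPerms n).subset fun _ hw => hw.1.1

theorem comp_mem_ribbonSet (hu : u ∈ EvenSignedPerms n) (hw : w ∈ ribbonSet n J)
    (h : ∀ i < n, u (w ((i : ℤ) + 1)) < u (letterBefore w i) ↔
      w ((i : ℤ) + 1) < letterBefore w i) : u ∘ w ∈ ribbonSet n J := by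
  refine ⟨EvenSignedPerms.comp hu hw.1, ?_⟩
  rw [← hw.2]
  ext i
  rw [mem_DesD, mem_DesD, SignedPerms.letterBefore_comp hu.1]
  exact and_congr_right fun hi => h i hi

/-- The elements of `ribbonSet n J` whose word starts with `±1, ±2` in some order, followed by
`±3, …, ±k`. -/
def initialSet (n : ℕ) (J : Set ℕ) (k : ℕ) : Set (ℤ → ℤ) :=
  {w ∈ ribbonSet n J | |w 1 * w 2| = 2 ∧ ∀ i : ℤ, 3 ≤ i → i ≤ k → |w i| = i}

theorem abs_pair_of_abs_mul_eq_two {x y : ℤ} (h : |x * y| = 2) :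
    |x| = 1 ∧ |y| = 2 ∨ |x| = 2 ∧ |y| = 1 := by
  rw [abs_mul] at h
  have := eq_of_mul_eq_two h
  have := abs_nonneg x
  omega

/-- In a signed permutation, `±1` and `±2` can only be adjacent in one place. -/
theorem abs_mul_eq_two_of_adjacent (hw : w ∈ SignedPerms n) {i j : ℕ}
    (hi : w ((i : ℤ) + 1) * letterBefore w i = 2) (hj : w ((j : ℤ) + 1) * letterBefore w j = -2) :
    |w 1 * w 2| = 2 := by
  have hij : i ≠ j := by rintro rfl; omega
  by_cases hi0 : i = 0
  · subst hi0
    simp only [letterBefore, if_true, Nat.cast_zero, zero_add] at hi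
    rw [show w 1 * w 2 = -2 by linarith]
    rfl
  by_cases hj0 : j = 0
  · subst hj0
    simp only [letterBefore, if_true, Nat.cast_zero, zero_add] at hj
    rw [show w 1 * w 2 = 2 by linarith]
    rfl
  rw [letterBefore, if_neg hi0] at hi
  rw [letterBefore, if_neg hj0] at hj
  have h1 := abs_pair_of_abs_mul_eq_two (x := w (i + 1)) (y := w i) (by rw [hi]; rfl)
  have h2 := abs_pair_of_abs_mul_eq_two (x := w (j + 1)) (y := w j) (by rw [hj]; rfl)
  have e (a b : ℤ) (ha : 1 ≤ a) (hb : 1 ≤ b) := SignedPerms.eq_of_abs_eq hw ha hb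
  have e1 := e (i + 1) (j + 1) (by omega) (by omega)
  have e2 := e (i + 1) j (by omega) (by omega)
  have e3 := e i (j + 1) (by omega) (by omega)
  have e4 := e i j (by omega) (by omega)
  omega

theorem odd_ncard_ribbonSet_iff (hn : 2 ≤ n) :
    Odd (ribbonSet n J).ncard ↔ Odd (initialSet n J 2).ncard := by
  set S := ribbonSet n J with hS
  set A := {w ∈ S | ∀ i < n, w ((i : ℤ) + 1) * letterBefore w i ≠ 2} with hA
  set B := {w ∈ S | (∃ i < n, w ((i : ℤ) + 1) * letterBefore w i = 2) ∧
    ∀ i < n, w ((i : ℤ) + 1) * letterBefore w i ≠ -2} with hB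
  set C := initialSet n J 2 with hC
  have hfin : S.Finite := finite_ribbonSet n J
  have hAfin : A.Finite := hfin.subset fun _ h => h.1
  have hBfin : B.Finite := hfin.subset fun _ h => h.1
  have hCfin : C.Finite := hfin.subset fun _ h => h.1
  have hAeven : Even A.ncard := by
    refine Set.even_ncard_of_involutive_comp hAfin swapOneTwo_involutive ?_ ?_
    · rintro w ⟨hw, h⟩
      have hsw := hw.1.1
      refine ⟨comp_mem_ribbonSet (swapOneTwo_mem hn) hw fun i hi => ?_, fun i hi h' => ?_⟩
      · exact swapOneTwo_lt_iff (SignedPerms.map_ne_zero hsw (by omega))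
          (SignedPerms.letterBefore_ne_zero hsw i)
          (SignedPerms.abs_letter_ne hsw i) (h i hi)
      · rw [SignedPerms.letterBefore_comp (swapOneTwo_mem hn).1] at h'
        have := swapOneTwo_mul_eq_two h'
        rw [Function.comp_apply, swapOneTwo_involutive, swapOneTwo_involutive] at this
        exact h i hi this
    · rintro w ⟨hw, -⟩ h
      obtain ⟨i, hi⟩ := hw.1.1.1.2 1
      have := congrFun h i
      rw [Function.comp_apply, hi] at this
      exact absurd this (by decide)
  have hBeven : Even B.ncard := by
    refine Set.even_ncard_of_involutive_comp hBfin negSwapOneTwo_involutive ?_ ?_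
    · rintro w ⟨hw, ⟨j, hj, hj'⟩, h⟩
      have hsw := hw.1.1
      refine ⟨comp_mem_ribbonSet (negSwapOneTwo_mem hn) hw fun i hi => ?_, ⟨j, hj, ?_⟩,
        fun i hi h' => ?_⟩
      · exact negSwapOneTwo_lt_iff (SignedPerms.map_ne_zero hsw (by omega))
          (SignedPerms.letterBefore_ne_zero hsw i)
          (SignedPerms.abs_letter_ne hsw i) (h i hi)
      · rw [SignedPerms.letterBefore_comp (negSwapOneTwo_mem hn).1]
        exact negSwapOneTwo_mul_eq_two hj'
      · rw [SignedPerms.letterBefore_comp (negSwapOneTwo_mem hn).1] at h'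
        have := negSwapOneTwo_mul_eq_neg_two h'
        rw [Function.comp_apply, negSwapOneTwo_involutive, negSwapOneTwo_involutive] at this
        exact h i hi this
    · rintro w ⟨hw, -⟩ h
      obtain ⟨i, hi⟩ := hw.1.1.1.2 1
      have := congrFun h i
      rw [Function.comp_apply, hi] at this
      exact absurd this (by decide)
  have hAB : Disjoint A B := by
    rw [Set.disjoint_left]
    rintro w ⟨-, h⟩ ⟨-, ⟨i, hi, hi'⟩, -⟩
    exact h i hi hi'
  have hC' : ∀ w ∈ C, (∃ i < n, w ((i : ℤ) + 1) * letterBefore w i = 2) ∧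
      ∃ i < n, w ((i : ℤ) + 1) * letterBefore w i = -2 := by
    rintro w ⟨-, h, -⟩
    have h0 : w (((0 : ℕ) : ℤ) + 1) * letterBefore w 0 = -(w 1 * w 2) := by
      simp [letterBefore]
    have h1 : w (((1 : ℕ) : ℤ) + 1) * letterBefore w 1 = w 1 * w 2 := by
      simp [letterBefore, mul_comm]
    rcases (abs_eq (by norm_num)).mp h with h | h
    · exact ⟨⟨1, by omega, by omega⟩, ⟨0, by omega, by omega⟩⟩
    · exact ⟨⟨0, by omega, by omega⟩, ⟨1, by omega, by omega⟩⟩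
  have hABC : Disjoint (A ∪ B) C := by
    rw [Set.disjoint_left]
    rintro w (⟨-, h⟩ | ⟨-, -, h⟩) hw
    · obtain ⟨i, hi, hi'⟩ := (hC' w hw).1
      exact h i hi hi'
    · obtain ⟨i, hi, hi'⟩ := (hC' w hw).2
      exact h i hi hi'
  have hunion : S = A ∪ B ∪ C := by
    ext w
    constructor
    · intro hw
      by_cases h2 : ∃ i < n, w ((i : ℤ) + 1) * letterBefore w i = 2
      · by_cases h3 : ∃ i < n, w ((i : ℤ) + 1) * letterBefore w i = -2
        · obtain ⟨i, -, hi⟩ := h2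
          obtain ⟨j, -, hj⟩ := h3
          refine Or.inr ⟨hw, abs_mul_eq_two_of_adjacent hw.1.1 hi hj, fun i h3 h2 => ?_⟩
          push_cast at h2
          omega
        · exact Or.inl (Or.inr ⟨hw, h2, by push Not at h3; exact h3⟩)
      · exact Or.inl (Or.inl ⟨hw, by push Not at h2; exact h2⟩)
    · rintro ((h | h) | h) <;> exact h.1
  rw [hunion, Set.ncard_union_eq hABC (hAfin.union hBfin) hCfin,
    Set.ncard_union_eq hAB hAfin hBfin, Nat.odd_add', iff_true_right (hAeven.add hBeven)]

/-- If `|w 1|, |w 2|` are `1, 2` in some order and `|w i| = i` for `3 ≤ i ≤ k`, then the letters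
of absolute value at most `k` are exactly the first `k` ones. -/
theorem SignedPerms.abs_le_iff (hw : w ∈ SignedPerms n) {k : ℕ} (hk : 2 ≤ k)
    (h12 : |w 1 * w 2| = 2) (h : ∀ i : ℤ, 3 ≤ i → i ≤ k → |w i| = i) {i : ℤ} (hi : 1 ≤ i) :
    |w i| ≤ k ↔ i ≤ k := by
  have h12' := abs_pair_of_abs_mul_eq_two h12
  constructor
  · intro hik
    have h0 := Int.one_le_abs (SignedPerms.map_ne_zero hw (i := i) (by omega))
    by_cases h3 : 3 ≤ |w i|
    · have := SignedPerms.eq_of_abs_eq hw (i := |w i|) (by omega) hi (h _ h3 hik)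
      omega
    · have e1 := SignedPerms.eq_of_abs_eq hw (i := i) (j := 1) hi le_rfl
      have e2 := SignedPerms.eq_of_abs_eq hw (i := i) (j := 2) hi (by norm_num)
      omega
  · intro hik
    by_cases h3 : 3 ≤ i
    · rw [h i h3 hik]; exact hik
    · obtain rfl | rfl : i = 1 ∨ i = 2 := by omega
      all_goals omega

theorem max_abs_letters_ne (hw : w ∈ SignedPerms n) {k : ℕ} (hk : 2 ≤ k)
    (h12 : |w 1 * w 2| = 2) (h : ∀ i : ℤ, 3 ≤ i → i ≤ k → |w i| = i) {i : ℕ}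
    (hne : i = k → |w ((i : ℤ) + 1)| ≠ k + 1) :
    max |w ((i : ℤ) + 1)| |letterBefore w i| ≠ (k : ℤ) + 1 := by
  have hx := SignedPerms.abs_le_iff hw hk h12 h (i := (i : ℤ) + 1) (by omega)
  by_cases hi0 : i = 0
  · subst hi0
    have hy := SignedPerms.abs_le_iff hw hk h12 h (i := 2) (by omega)
    simp only [letterBefore, if_true, abs_neg]
    omega
  · have hy := SignedPerms.abs_le_iff hw hk h12 h (i := (i : ℤ)) (by omega)
    have := SignedPerms.abs_letter_ne hw i
    simp only [letterBefore, if_neg hi0] at this ⊢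
    omega

theorem odd_ncard_initialSet_succ_iff {k : ℕ} (hk : 2 ≤ k) (hkn : k + 1 ≤ n) :
    Odd (initialSet n J k).ncard ↔ Odd (initialSet n J (k + 1)).ncard := by
  have hsub : initialSet n J (k + 1) ⊆ initialSet n J k := by
    rintro w ⟨hw, h12, h⟩
    exact ⟨hw, h12, fun i h3 hi => h i h3 (by push_cast; omega)⟩
  have hfin : (initialSet n J k).Finite := (finite_ribbonSet n J).subset fun _ h => h.1
  have hmem := flipOne_mem (n := n) (m := (k : ℤ) + 1) (by omega) (by omega)
  have hnot : ∀ w ∈ initialSet n J k,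
      (w ∈ initialSet n J (k + 1) ↔ |w ((k : ℤ) + 1)| = k + 1) := by
    rintro w ⟨hw, h12, h⟩
    constructor
    · rintro ⟨-, -, h'⟩
      exact h' _ (by omega) (by push_cast; omega)
    · intro h'
      refine ⟨hw, h12, fun i h3 hi => ?_⟩
      push_cast at hi
      rcases hi.eq_or_lt with rfl | hi
      · exact h'
      · exact h i h3 (by omega)
  have heven : Even (initialSet n J k \ initialSet n J (k + 1)).ncard := by
    refine Set.even_ncard_of_involutive_comp (g := flipOne (k + 1)) (hfin.subset Set.sdiff_subset)
      (flipOne_involutive _) ?_ ?_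
    · rintro w ⟨hw, hw'⟩
      rw [hnot w hw] at hw'
      have hsw := hw.1.1.1
      have hgw : flipOne (k + 1) ∘ w ∈ initialSet n J k := by
        refine ⟨comp_mem_ribbonSet hmem hw.1 fun i hi => ?_, ?_, ?_⟩
        · exact flipOne_lt_iff (SignedPerms.map_ne_zero hsw (by omega))
            (SignedPerms.letterBefore_ne_zero hsw i)
            (SignedPerms.abs_letter_ne hsw i)
            (max_abs_letters_ne hsw hk hw.2.1 hw.2.2 (by rintro rfl; exact hw'))
        · rw [Function.comp_apply, Function.comp_apply, abs_mul, abs_flipOne, abs_flipOne,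
            ← abs_mul]
          exact hw.2.1
        · intro i h3 hi
          rw [Function.comp_apply, abs_flipOne]
          exact hw.2.2 i h3 hi
      refine ⟨hgw, ?_⟩
      rw [hnot _ hgw, Function.comp_apply, abs_flipOne]
      exact hw'
    · rintro w ⟨hw, -⟩ h
      obtain ⟨i, hi⟩ := hw.1.1.1.1.2 1
      have := congrFun h i
      rw [Function.comp_apply, hi] at this
      simp [flipOne] at this
  rw [← Set.ncard_sdiff_add_ncard_of_subset hsub hfin, Nat.odd_add', iff_true_right heven]

theorem eq_of_abs_eq_of_lt_iff {a b c d : ℤ} (hab : |a| = |b|) (hc : |c| < |a|)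
    (hd : |d| < |a|) (h : a < c ↔ b < d) : a = b := by
  rw [abs_lt] at hc hd
  rcases abs_cases a with ⟨h1, _⟩ | ⟨h1, _⟩ <;> rcases abs_cases b with ⟨h2, _⟩ | ⟨h2, _⟩ <;>
    omega

theorem eq_or_eq_neg_of_lt_iff {a b c d : ℤ} (hab : |a * b| = 2) (hcd : |c * d| = 2)
    (h0 : a < -b ↔ c < -d) (h1 : b < a ↔ d < c) :
    (a = c ∨ a = -c) ∧ b = d ∨ a = c ∧ (b = d ∨ b = -d) := by
  have hp := abs_pair_of_abs_mul_eq_two hab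
  have hq := abs_pair_of_abs_mul_eq_two hcd
  simp only [abs_eq (zero_le_one' ℤ), abs_eq (zero_le_two (α := ℤ))] at hp hq
  omega

theorem initialSet_subsingleton (hn : 2 ≤ n) : (initialSet n J n).Subsingleton := by
  rintro w ⟨⟨⟨hw, hwe⟩, hwJ⟩, hw12, hwn⟩ u ⟨⟨⟨hu, hue⟩, huJ⟩, hu12, hun⟩
  have hdes : ∀ i < n, w ((i : ℤ) + 1) < letterBefore w i ↔
      u ((i : ℤ) + 1) < letterBefore u i := by
    intro i hi
    have : i ∈ DesD n w ↔ i ∈ DesD n u := by rw [hwJ, huJ]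
    simpa [mem_DesD, hi] using this
  have h3 : ∀ i : ℤ, 3 ≤ i → i ≤ n → w i = u i := by
    intro i hi hin
    obtain ⟨k, rfl⟩ : ∃ k : ℕ, i = (k : ℤ) + 1 := ⟨(i - 1).toNat, by omega⟩
    have hd := hdes k (by omega)
    simp only [letterBefore, if_neg (show k ≠ 0 by omega)] at hd
    have h1 := (SignedPerms.abs_le_iff hw (k := k) (by omega) hw12
      (fun i h3 hi => hwn i h3 (by omega)) (i := k) (by omega)).mpr le_rfl
    have h2 := (SignedPerms.abs_le_iff hu (k := k) (by omega) hu12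
      (fun i h3 hi => hun i h3 (by omega)) (i := k) (by omega)).mpr le_rfl
    have h4 := hwn _ hi hin
    have h5 := hun _ hi hin
    exact eq_of_abs_eq_of_lt_iff (by omega) (by omega) (by omega) hd
  have hd0 := hdes 0 (by omega)
  have hd1 := hdes 1 (by omega)
  simp only [letterBefore, if_true, Nat.cast_zero, zero_add] at hd0
  simp only [letterBefore, one_ne_zero, if_false, Nat.cast_one, one_add_one_eq_two] at hd1
  have h12 := eq_or_eq_neg_of_lt_iff hw12 hu12 hd0 hd1
  rw [SignedPerms.even_card_iff hw] at hwe
  rw [SignedPerms.even_card_iff hu] at hue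
  have hparity : ∀ p ∈ Finset.Icc (1 : ℤ) n,
      (∀ i ∈ Finset.Icc (1 : ℤ) n, i ≠ p → w i = u i) → w p ≠ -u p := by
    intro p hp hne hwp
    have h : ∏ i ∈ Finset.Icc (1 : ℤ) n, (w i).sign * (u i).sign = (w p).sign * (u p).sign := by
      refine Finset.prod_eq_single p (fun i hi hip => ?_) (fun h => absurd hp h)
      rw [hne i hi hip, ← Int.sign_mul]
      rw [Finset.mem_Icc] at hi
      exact Int.sign_eq_one_of_pos (mul_self_pos.mpr (SignedPerms.map_ne_zero hu (by omega)))
    rw [Finset.prod_mul_distrib, hwe, hue, hwp, ← Int.sign_mul] at h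
    have hneg : -u p * u p < 0 := by
      rw [Finset.mem_Icc] at hp
      have := mul_self_pos.mpr (SignedPerms.map_ne_zero hu (i := p) (by omega))
      linarith
    rw [Int.sign_eq_neg_one_of_neg hneg] at h
    norm_num at h
  have hpos : ∀ i : ℤ, 1 ≤ i → i ≤ n → w i = u i := by
    have hw1 : w 1 = u 1 ∧ w 2 = u 2 := by
      have p1 := hparity 1 (Finset.mem_Icc.mpr (by omega))
      have p2 := hparity 2 (Finset.mem_Icc.mpr (by omega))
      rcases h12 with ⟨h1 | h1, h2⟩ | ⟨h1, h2 | h2⟩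
      · exact ⟨h1, h2⟩
      · refine absurd h1 (p1 fun i hi hi1 => ?_)
        rw [Finset.mem_Icc] at hi
        rcases eq_or_ne i 2 with rfl | hi2
        · exact h2
        · exact h3 i (by omega) hi.2
      · exact ⟨h1, h2⟩
      · refine absurd h2 (p2 fun i hi hi2 => ?_)
        rw [Finset.mem_Icc] at hi
        rcases eq_or_ne i 1 with rfl | hi1
        · exact h1
        · exact h3 i (by omega) hi.2
    intro i hi hin
    by_cases hi3 : 3 ≤ i
    · exact h3 i hi3 hin
    · obtain rfl | rfl : i = 1 ∨ i = 2 := by omega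
      exacts [hw1.1, hw1.2]
  have hnonneg : ∀ i : ℤ, 0 ≤ i → w i = u i := by
    intro i hi
    rcases hi.eq_or_lt with rfl | hi'
    · rw [SignedPerms.map_zero hw, SignedPerms.map_zero hu]
    · by_cases hin : i ≤ n
      · exact hpos i hi' hin
      · have : (n : ℤ) < |i| := by rw [abs_of_nonneg hi]; omega
        rw [hw.2.2 i this, hu.2.2 i this]
  funext i
  rcases le_total 0 i with hi | hi
  · exact hnonneg i hi
  · have := hnonneg (-i) (by omega)
    rw [hw.2.1, hu.2.1] at this
    omega

theorem exists_evenSignedPerms_with_descents (hn : 2 ≤ n) (J : Set ℕ) {k : ℕ} (hk : 2 ≤ k)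
    (hkn : k ≤ n) :
    ∃ w ∈ EvenSignedPerms n, |w 1 * w 2| = 2 ∧ (∀ i : ℤ, 3 ≤ i → i ≤ n → |w i| = i) ∧
      ∀ i < k, (w ((i : ℤ) + 1) < letterBefore w i ↔ i ∈ J) := by
  induction k, hk using Nat.le_induction with
  | base =>
    have hid : id ∈ EvenSignedPerms n := by
      have := EvenSignedPerms.comp (swapOneTwo_mem hn) (swapOneTwo_mem hn)
      rwa [swapOneTwo_involutive.comp_self] at this
    have h3 : ∀ i : ℤ, 3 ≤ i → swapOneTwo i = i ∧ negSwapOneTwo i = i := by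
      intro i hi
      unfold swapOneTwo negSwapOneTwo
      split_ifs <;> omega
    have h0 : ∀ i : ℤ, 3 ≤ i → |i| = i := fun i hi => abs_of_nonneg (by omega)
    have key : ∀ w ∈ EvenSignedPerms n, |w 1 * w 2| = 2 → (∀ i : ℤ, 3 ≤ i → w i = i) →
        (w 1 < -w 2 ↔ 0 ∈ J) → (w 2 < w 1 ↔ 1 ∈ J) →
        ∃ w ∈ EvenSignedPerms n, |w 1 * w 2| = 2 ∧ (∀ i : ℤ, 3 ≤ i → i ≤ n → |w i| = i) ∧
          ∀ i : ℕ, i < 2 → (w ((i : ℤ) + 1) < letterBefore w i ↔ i ∈ J) := by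
      intro w hw h12 h h0J h1J
      refine ⟨w, hw, h12, fun i hi _ => by rw [h i hi, h0 i hi], fun i hi => ?_⟩
      interval_cases i
      · simpa [letterBefore] using h0J
      · simpa [letterBefore] using h1J
    by_cases hJ0 : 0 ∈ J <;> by_cases hJ1 : 1 ∈ J
    · exact key _ (EvenSignedPerms.comp (negSwapOneTwo_mem hn) (swapOneTwo_mem hn)) (by decide)
        (fun i hi => by simp [h3 i hi]) (iff_of_true (by decide) hJ0) (iff_of_true (by decide) hJ1)
    · exact key _ (negSwapOneTwo_mem hn) (by decide)
        (fun i hi => (h3 i hi).2) (iff_of_true (by decide) hJ0) (iff_of_false (by decide) hJ1)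
    · exact key _ (swapOneTwo_mem hn) (by decide)
        (fun i hi => (h3 i hi).1) (iff_of_false (by decide) hJ0) (iff_of_true (by decide) hJ1)
    · exact key _ hid (by decide)
        (fun i hi => rfl) (iff_of_false (by decide) hJ0) (iff_of_false (by decide) hJ1)
  | succ k hk ih =>
    obtain ⟨w, hw, h12, h, hJ⟩ := ih (by omega)
    have hsw := hw.1
    have hk' : ∀ i : ℤ, 3 ≤ i → i ≤ k → |w i| = i := fun i h3 hi => h i h3 (by omega)
    by_cases hd : w ((k : ℤ) + 1) < letterBefore w k ↔ k ∈ J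
    · refine ⟨w, hw, h12, h, fun i hi => ?_⟩
      rcases (Nat.lt_succ_iff.mp hi).eq_or_lt with rfl | hi
      · exact hd
      · exact hJ i hi
    · have hmem := flipOne_mem (n := n) (m := (k : ℤ) + 1) (by omega) (by omega)
      refine ⟨_, EvenSignedPerms.comp hmem hw, ?_, ?_, fun i hi => ?_⟩
      · rw [Function.comp_apply, Function.comp_apply, abs_mul, abs_flipOne, abs_flipOne,
          ← abs_mul]
        exact h12
      · intro i h3 hi
        rw [Function.comp_apply, abs_flipOne]
        exact h i h3 hi
      · rw [SignedPerms.letterBefore_comp hmem.1, Function.comp_apply]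
        rcases (Nat.lt_succ_iff.mp hi).eq_or_lt with rfl | hi
        · have hle := (SignedPerms.abs_le_iff hsw hk h12 hk' (i := i) (by omega)).mpr le_rfl
          rw [flipOne_lt_iff_not (by omega) ?_ (h _ (by omega) (by omega))]
          · tauto
          · rw [letterBefore, if_neg (by omega)]
            omega
        · rw [flipOne_lt_iff (SignedPerms.map_ne_zero hsw (by omega))
            (SignedPerms.letterBefore_ne_zero hsw i)
            (SignedPerms.abs_letter_ne hsw i) (max_abs_letters_ne hsw hk h12 hk' (by omega))]
          exact hJ i hi

theorem initialSet_nonempty (hn : 2 ≤ n) (hJ : ∀ i ∈ J, i < n) : (initialSet n J n).Nonempty := by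
  obtain ⟨w, hw, h12, h, hd⟩ := exists_evenSignedPerms_with_descents hn J hn le_rfl
  refine ⟨w, ⟨hw, ?_⟩, h12, h⟩
  ext i
  rw [mem_DesD]
  exact ⟨fun hi => (hd i hi.1).mp hi.2, fun hi => ⟨hJ i hi, (hd i (hJ i hi)).mpr hi⟩⟩

/-- For `n ≥ 2`, every subset of `{0, …, n-1}` is the type D descent set of an odd number of even
signed permutations. -/
theorem odd_ncard_ribbonSet (hn : 2 ≤ n) (hJ : ∀ i ∈ J, i < n) : Odd (ribbonSet n J).ncard := by
  have h : ∀ k, 2 ≤ k → k ≤ n → (Odd (ribbonSet n J).ncard ↔ Odd (initialSet n J k).ncard) := by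
    intro k hk
    induction k, hk using Nat.le_induction with
    | base => exact fun _ => odd_ncard_ribbonSet_iff hn
    | succ k hk ih =>
      exact fun hkn => (ih (by omega)).trans (odd_ncard_initialSet_succ_iff hk hkn)
  obtain ⟨w, hw⟩ := initialSet_nonempty hn hJ
  rw [h n hn le_rfl, (initialSet_subsingleton hn).eq_singleton_of_mem hw, Set.ncard_singleton]
  exact odd_one

end Ribbon

theorem lt_of_mem_DsetB {n : ℕ} {α : PseudoComposition n} {m : ℕ} (hm : m ∈ DsetB α) :
    m < n := by
  obtain ⟨i, hi, hil, rfl⟩ := hm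
  have hsum := List.sum_take_add_sum_drop α.parts i
  rw [α.sum_eq, List.drop_eq_getElem_cons hil, List.sum_cons] at hsum
  have hpos : 0 < α.parts[i] := by
    refine α.tail_pos _ (List.mem_iff_getElem.mpr ⟨i - 1, by simp; omega, ?_⟩)
    simp [Nat.sub_add_cancel hi]
  omega

/-- For n ≥ 4, every type D ribbon number is odd. -/
theorem ribbonD_odd {n : ℕ} (hn : 4 ≤ n) (α : PseudoComposition n) :
    Odd (Set.ncard {w ∈ EvenSignedPerms n | DesD n w = DsetB α}) :=
  odd_ncard_ribbonSet (by omega) fun _ hi => lt_of_mem_DsetB hi
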